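/- arXiv:0707.3532 — 2 statements merged into one kernel-verified Lean document; each statement's English description precedes it below -/
import Mathlib

section
/- Let S₁(x) = x/3, S₂(x) = (x+2)/3 on X = [0,1], let A ⊆ [0,1] be a Borel set with at most countable topological boundary, p ∈ (0,1/2), p₁ = p·1_A + (1−p)·1_{Aᶜ}, p₂ = 1 − p₁. Then there exists at least one probability measure μ on [0,1] invariant under the iterated function system {X, S_i, p_i}. -/
open MeasureTheory Set
open scoped ENNReal NNReal

namespace IFSaux

open Filter Topology

/-- The Markov operator on measures. -/
noncomputable def T (A : Set ℝ) (a b : ℝ≥0) (μ : Measure ℝ) : Measure ℝ :=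
  (a • μ.restrict A + b • μ.restrict Aᶜ).map (fun x => x / 3)
    + (b • μ.restrict A + a • μ.restrict Aᶜ).map (fun x => (x + 2) / 3)

lemma T_apply {A : Set ℝ} (a b : ℝ≥0) (μ : Measure ℝ) {B : Set ℝ}
    (hB : MeasurableSet B) :
    T A a b μ B = (a * μ ((fun x => x / 3) ⁻¹' B ∩ A) + b * μ ((fun x => x / 3) ⁻¹' B ∩ Aᶜ))
      + (b * μ ((fun x => (x + 2) / 3) ⁻¹' B ∩ A)
        + a * μ ((fun x => (x + 2) / 3) ⁻¹' B ∩ Aᶜ)) := by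
  have h1 : Measurable (fun x : ℝ => x / 3) := by fun_prop
  have h2 : Measurable (fun x : ℝ => (x + 2) / 3) := by fun_prop
  simp only [T, Measure.add_apply, Measure.map_apply h1 hB, Measure.map_apply h2 hB,
    Measure.smul_apply, Measure.restrict_apply (h1 hB), Measure.restrict_apply (h2 hB)]
  rfl

/-- The invariant class of measures. -/
structure Good (b : ℝ≥0) (μ : Measure ℝ) : Prop where
  prob : μ univ = 1
  supp : μ (Icc 0 1)ᶜ = 0
  ball : ∀ (n : ℕ) (x : ℝ), μ (Metric.ball x ((1 / 3) ^ n / 2)) ≤ (b : ℝ≥0∞) ^ n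

lemma split {A : Set ℝ} (hA : MeasurableSet A) {a b : ℝ≥0} (hab : a ≤ b) (μ : Measure ℝ)
    (E : Set ℝ) : a * μ (E ∩ A) + b * μ (E ∩ Aᶜ) ≤ b * μ E ∧
      b * μ (E ∩ A) + a * μ (E ∩ Aᶜ) ≤ b * μ E := by
  have h : μ E = μ (E ∩ A) + μ (E ∩ Aᶜ) := by
    rw [← measure_inter_add_sdiff E hA, sdiff_eq]
  rw [h, mul_add]
  have : (a : ℝ≥0∞) ≤ b := by exact_mod_cast hab
  constructor <;> gcongr

lemma Good.T {A : Set ℝ} (hA : MeasurableSet A) {a b : ℝ≥0} (hab : a ≤ b) (h1 : a + b = 1)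
    {μ : Measure ℝ} (hμ : Good b μ) : Good b (T A a b μ) := by
  have h1' : (a : ℝ≥0∞) + b = 1 := by exact_mod_cast h1
  have hs : μ A + μ Aᶜ = 1 := by rw [measure_add_measure_compl hA, hμ.prob]
  have hprob : IFSaux.T A a b μ univ = 1 := by
    rw [T_apply a b μ MeasurableSet.univ]
    simp only [preimage_univ, univ_inter]
    calc _ = ((a : ℝ≥0∞) + b) * (μ A + μ Aᶜ) := by ring
      _ = 1 := by rw [h1', hs, one_mul]
  refine ⟨hprob, ?_, ?_⟩
  · rw [T_apply a b μ measurableSet_Icc.compl]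
    have e1 : μ ((fun x : ℝ => x / 3) ⁻¹' (Icc 0 1)ᶜ) = 0 := by
      refine measure_mono_null ?_ hμ.supp
      intro x hx hx'
      apply hx
      simp only [mem_Icc] at hx' ⊢
      constructor <;> linarith
    have e2 : μ ((fun x : ℝ => (x + 2) / 3) ⁻¹' (Icc 0 1)ᶜ) = 0 := by
      refine measure_mono_null ?_ hμ.supp
      intro x hx hx'
      apply hx
      simp only [mem_Icc] at hx' ⊢
      constructor <;> linarith
    rw [measure_inter_null_of_null_left _ e1, measure_inter_null_of_null_left _ e1,
      measure_inter_null_of_null_left _ e2, measure_inter_null_of_null_left _ e2]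
    simp
  · intro n x
    rcases n with _ | n
    · calc _ ≤ IFSaux.T A a b μ univ := measure_mono (subset_univ _)
        _ = _ := by rw [hprob]; simp
    rw [T_apply a b μ Metric.isOpen_ball.measurableSet]
    have hr : ((1 : ℝ) / 3) ^ n ≤ 1 := pow_le_one₀ (by norm_num) (by norm_num)
    have hr' : ((1 : ℝ) / 3) ^ (n + 1) / 2 = ((1 : ℝ) / 3) ^ n / 6 := by rw [pow_succ]; ring
    rw [hr']
    set r := ((1 : ℝ) / 3) ^ n with hrdef
    have m1 : (fun y : ℝ => y / 3) ⁻¹' (Metric.ball x (r / 6)) = Metric.ball (3 * x) (r / 2) := by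
      ext y
      simp only [mem_preimage, Metric.mem_ball, Real.dist_eq, abs_lt]
      constructor <;> rintro ⟨h, h'⟩ <;> constructor <;> linarith
    have m2 : (fun y : ℝ => (y + 2) / 3) ⁻¹' (Metric.ball x (r / 6))
        = Metric.ball (3 * x - 2) (r / 2) := by
      ext y
      simp only [mem_preimage, Metric.mem_ball, Real.dist_eq, abs_lt]
      constructor <;> rintro ⟨h, h'⟩ <;> constructor <;> linarith
    rw [m1, m2]
    have s1 := (split hA hab μ (Metric.ball (3 * x) (r / 2))).1
    have s2 := (split hA hab μ (Metric.ball (3 * x - 2) (r / 2))).2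
    have b1 := hμ.ball n (3 * x)
    have b2 := hμ.ball n (3 * x - 2)
    rw [pow_succ']
    refine (add_le_add s1 s2).trans ?_
    rcases le_or_gt x (1 / 2) with hx | hx
    · have : μ (Metric.ball (3 * x - 2) (r / 2)) = 0 := by
        refine measure_mono_null ?_ hμ.supp
        intro y hy hy'
        simp only [Metric.mem_ball, Real.dist_eq, abs_lt, mem_Icc] at hy hy'
        linarith [hy.2, hy'.1]
      rw [this, mul_zero, add_zero]
      gcongr
    · have : μ (Metric.ball (3 * x) (r / 2)) = 0 := by
        refine measure_mono_null ?_ hμ.supp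
        intro y hy hy'
        simp only [Metric.mem_ball, Real.dist_eq, abs_lt, mem_Icc] at hy hy'
        linarith [hy.1, hy'.2]
      rw [this, mul_zero, zero_add]
      gcongr

lemma good_init {b : ℝ≥0} (hb : 1 / 3 ≤ (b : ℝ)) : Good b (volume.restrict (Icc (0 : ℝ) 1)) := by
  refine ⟨by simp, ?_, ?_⟩
  · rw [Measure.restrict_apply measurableSet_Icc.compl]; simp
  · intro n x
    refine (Measure.restrict_apply_le _ _).trans ?_
    rw [Real.volume_ball, ← ENNReal.ofReal_coe_nnreal, ← ENNReal.ofReal_pow (by positivity)]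
    apply ENNReal.ofReal_le_ofReal
    rw [mul_div_cancel₀ _ (by norm_num)]
    gcongr

/-- Cesaro averages. -/
noncomputable def avg (A : Set ℝ) (a b : ℝ≥0) (N : ℕ) : Measure ℝ :=
  ((N + 1 : ℝ≥0)⁻¹) • ∑ k ∈ Finset.range (N + 1), (T A a b)^[k] (volume.restrict (Icc (0 : ℝ) 1))

lemma avg_apply (A : Set ℝ) (a b : ℝ≥0) (N : ℕ) (B : Set ℝ) :
    avg A a b N B = ((N + 1 : ℝ≥0)⁻¹ : ℝ≥0) *
      ∑ k ∈ Finset.range (N + 1), (T A a b)^[k] (volume.restrict (Icc (0 : ℝ) 1)) B := by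
  simp only [avg, Measure.smul_apply, Measure.finsetSum_apply]
  rfl

lemma good_iter {A : Set ℝ} (hA : MeasurableSet A) {a b : ℝ≥0} (hab : a ≤ b) (h1 : a + b = 1)
    (hb : 1 / 3 ≤ (b : ℝ)) (k : ℕ) :
    Good b ((T A a b)^[k] (volume.restrict (Icc (0 : ℝ) 1))) := by
  induction k with
  | zero => exact good_init hb
  | succ k ih => rw [Function.iterate_succ_apply']; exact ih.T hA hab h1

lemma c_mul (N : ℕ) (z : ℝ≥0∞) :
    (((N + 1 : ℝ≥0)⁻¹ : ℝ≥0) : ℝ≥0∞) * ∑ _k ∈ Finset.range (N + 1), z = z := by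
  have : (((N + 1 : ℝ≥0)⁻¹ : ℝ≥0) : ℝ≥0∞) * ((N + 1 : ℕ) : ℝ≥0∞) = 1 := by
    have h : ((N + 1 : ℝ≥0)⁻¹ : ℝ≥0) * ((N + 1 : ℕ) : ℝ≥0) = 1 := by
      push_cast
      exact inv_mul_cancel₀ (by positivity)
    exact_mod_cast h
  rw [Finset.sum_const, Finset.card_range, nsmul_eq_mul, ← mul_assoc, this, one_mul]

lemma good_avg {A : Set ℝ} (hA : MeasurableSet A) {a b : ℝ≥0} (hab : a ≤ b) (h1 : a + b = 1)
    (hb : 1 / 3 ≤ (b : ℝ)) (N : ℕ) : Good b (avg A a b N) := by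
  have g := good_iter hA hab h1 hb
  refine ⟨?_, ?_, ?_⟩
  · rw [avg_apply, Finset.sum_congr rfl (fun k _ => (g k).prob), c_mul]
  · rw [avg_apply, Finset.sum_congr rfl (fun k _ => (g k).supp), c_mul]
  · intro n x
    rw [avg_apply, ← c_mul N ((b : ℝ≥0∞) ^ n)]
    gcongr with k _
    exact (g k).ball n x

lemma T_avg {A : Set ℝ} (a b : ℝ≥0) (N : ℕ) {B : Set ℝ} (hB : MeasurableSet B) :
    T A a b (avg A a b N) B = ((N + 1 : ℝ≥0)⁻¹ : ℝ≥0) *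
      ∑ k ∈ Finset.range (N + 1), (T A a b)^[k + 1] (volume.restrict (Icc (0 : ℝ) 1)) B := by
  rw [T_apply a b _ hB]
  simp only [Function.iterate_succ_apply', T_apply a b _ hB, avg_apply, Finset.sum_add_distrib,
    ← Finset.mul_sum]
  ring

lemma T_avg_close {A : Set ℝ} (hA : MeasurableSet A) {a b : ℝ≥0} (hab : a ≤ b) (h1 : a + b = 1)
    (hb : 1 / 3 ≤ (b : ℝ)) (N : ℕ) {B : Set ℝ} (hB : MeasurableSet B) :
    T A a b (avg A a b N) B ≤ avg A a b N B + ((N + 1 : ℝ≥0)⁻¹ : ℝ≥0) ∧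
    avg A a b N B ≤ T A a b (avg A a b N) B + ((N + 1 : ℝ≥0)⁻¹ : ℝ≥0) := by
  have g := good_iter hA hab h1 hb
  rw [T_avg a b N hB, avg_apply]
  set m := fun k => (T A a b)^[k] (volume.restrict (Icc (0 : ℝ) 1)) B with hm
  have hm1 : ∀ k, m k ≤ 1 := fun k => (measure_mono (subset_univ _)).trans (g k).prob.le
  have e : ∑ k ∈ Finset.range (N + 1), m (k + 1) + m 0
      = ∑ k ∈ Finset.range (N + 1), m k + m (N + 1) := by
    rw [← Finset.sum_range_succ', Finset.sum_range_succ]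
  set c : ℝ≥0∞ := (((N + 1 : ℝ≥0)⁻¹ : ℝ≥0) : ℝ≥0∞)
  change c * ∑ k ∈ Finset.range (N + 1), m (k + 1) ≤ c * ∑ k ∈ Finset.range (N + 1), m k + c ∧
    c * ∑ k ∈ Finset.range (N + 1), m k ≤ c * ∑ k ∈ Finset.range (N + 1), m (k + 1) + c
  have f : ∀ z : ℝ≥0∞, c * z + c = c * (z + 1) := fun z => by ring
  rw [f, f]
  constructor
  · gcongr
    calc _ ≤ _ := le_self_add
      _ = _ := e
      _ ≤ _ := by gcongr; exact hm1 _
  · gcongr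
    calc _ ≤ _ := le_self_add
      _ = _ := e.symm
      _ ≤ _ := by gcongr; exact hm1 _

lemma exists_inv {A : Set ℝ} (hA : MeasurableSet A) (hAc : (frontier A).Countable)
    {a b : ℝ≥0} (hab : a ≤ b) (h1 : a + b = 1)
    (hb : 1 / 3 ≤ (b : ℝ)) (hb1 : b < 1) :
    ∃ μ : Measure ℝ, IsProbabilityMeasure μ ∧ μ (Icc (0 : ℝ) 1)ᶜ = 0 ∧ T A a b μ = μ := by
  have g := good_avg hA hab h1 hb
  let ν : ℕ → ProbabilityMeasure ℝ := fun N => ⟨avg A a b N, ⟨(g N).prob⟩⟩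
  have hν : ∀ N, (ν N : Measure ℝ) = avg A a b N := fun N => rfl
  let U : Ultrafilter ℕ := hyperfilter ℕ
  have hU : (U : Filter ℕ) ≤ atTop := Nat.hyperfilter_le_atTop
  have hK := isCompact_setOfPred_probabilityMeasure_mass_eq_compl_isCompact_le (E := ℝ)
    (u := fun _ => 0) (K := fun _ => Icc (0 : ℝ) 1) tendsto_const_nhds (fun _ => isCompact_Icc)
    (Or.inl inferInstance)
  obtain ⟨μ, hμK, hμ⟩ := hK.ultrafilter_le_nhds' (U.map ν) (by
    refine Filter.Eventually.of_forall (f := (U : Filter ℕ)) ?_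
    intro N n
    have : (ν N : Measure ℝ) (Icc 0 1)ᶜ = 0 := (g N).supp
    simp [this])
  have hlim : Tendsto ν U (𝓝 μ) := hμ
  have hball : ∀ (n : ℕ) (x : ℝ),
      (μ : Measure ℝ) (Metric.ball x ((1 / 3) ^ n / 2)) ≤ (b : ℝ≥0∞) ^ n := by
    intro n x
    refine (ProbabilityMeasure.le_liminf_measure_open_of_tendsto hlim Metric.isOpen_ball).trans ?_
    refine (liminf_le_liminf (Eventually.of_forall fun N => (g N).ball n x)).trans ?_
    exact (liminf_const _).le
  have hna : NullSingletonClass (μ : Measure ℝ) := by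
    refine ⟨fun x => ?_⟩
    have ht : Tendsto (fun n : ℕ => (b : ℝ≥0∞) ^ n) atTop (𝓝 0) :=
      ENNReal.tendsto_pow_atTop_nhds_zero_of_lt_one (by exact_mod_cast hb1)
    refine le_antisymm (ge_of_tendsto' ht fun n => ?_) zero_le
    refine (measure_mono ?_).trans (hball n x)
    rw [singleton_subset_iff]
    exact Metric.mem_ball_self (by positivity)
  have hE : ∀ E : Set ℝ, (frontier E).Countable →
      Tendsto (fun N => avg A a b N E) U (𝓝 ((μ : Measure ℝ) E)) := fun E hEc =>
    ProbabilityMeasure.tendsto_measure_of_null_frontier_of_tendsto' hlim (hEc.measure_zero _)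
  have hfr : ∀ (s : ℝ) (C : Set ℝ), (frontier C).Countable →
      (frontier (Iic s ∩ C)).Countable := by
    intro s C hC
    refine Countable.mono (frontier_inter_subset _ _) ?_
    refine Countable.union (Countable.mono inter_subset_left ?_) (Countable.mono inter_subset_right hC)
    rw [frontier_Iic]
    exact countable_singleton _
  have hAc' : (frontier Aᶜ).Countable := by rwa [frontier_compl]
  have hTlim : ∀ t : ℝ, Tendsto (fun N => T A a b (avg A a b N) (Iic t)) U
      (𝓝 (T A a b μ (Iic t))) := by
    intro t
    have m1 : (fun y : ℝ => y / 3) ⁻¹' (Iic t) = Iic (3 * t) := by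
      ext y
      simp only [mem_preimage, mem_Iic]
      constructor <;> intro h <;> linarith
    have m2 : (fun y : ℝ => (y + 2) / 3) ⁻¹' (Iic t) = Iic (3 * t - 2) := by
      ext y
      simp only [mem_preimage, mem_Iic]
      constructor <;> intro h <;> linarith
    simp only [T_apply a b _ measurableSet_Iic, m1, m2]
    refine ((ENNReal.Tendsto.const_mul (hE _ (hfr _ _ hAc)) (Or.inr ENNReal.coe_ne_top)).add
      (ENNReal.Tendsto.const_mul (hE _ (hfr _ _ hAc')) (Or.inr ENNReal.coe_ne_top))).add
      ((ENNReal.Tendsto.const_mul (hE _ (hfr _ _ hAc)) (Or.inr ENNReal.coe_ne_top)).add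
      (ENNReal.Tendsto.const_mul (hE _ (hfr _ _ hAc')) (Or.inr ENNReal.coe_ne_top)))
  have hc : Tendsto (fun N : ℕ => (((N + 1 : ℝ≥0)⁻¹ : ℝ≥0) : ℝ≥0∞)) U (𝓝 0) := by
    refine Tendsto.mono_left ?_ hU
    have : Tendsto (fun N : ℕ => ((N + 1 : ℝ≥0)⁻¹ : ℝ≥0)) atTop (𝓝 0) := by
      have := tendsto_one_div_add_atTop_nhds_zero_nat (𝕜 := ℝ≥0)
      simpa using this
    have h := ENNReal.tendsto_coe.2 this
    rwa [ENNReal.coe_zero] at h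
  refine ⟨μ, inferInstance, ?_, ?_⟩
  · have := hμK 0
    simpa using this
  · symm
    refine Measure.ext_of_Iic _ _ fun t => ?_
    have hI : Tendsto (fun N => avg A a b N (Iic t)) U (𝓝 ((μ : Measure ℝ) (Iic t))) :=
      hE _ (by rw [frontier_Iic]; exact countable_singleton _)
    have cl := fun N => T_avg_close hA hab h1 hb N (measurableSet_Iic (a := t))
    apply le_antisymm
    · have := le_of_tendsto_of_tendsto' hI ((hTlim t).add hc) (fun N => (cl N).2)
      simpa using this
    · have := le_of_tendsto_of_tendsto' (hTlim t) (hI.add hc) (fun N => (cl N).1)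
      simpa using this

end IFSaux

/-- For the IFS `S₁(x) = x/3`, `S₂(x) = (x+2)/3` on `X = [0,1]` with
`A ⊆ [0,1]` Borel with at most countable boundary, `p ∈ (0,1/2)`,
`p₁ = p·1_A + (1-p)·1_{Aᶜ}`, `p₂ = 1 - p₁`, there exists at least one invariant
probability measure `μ`. -/
theorem stmt12 (A : Set ℝ) (hA : MeasurableSet A) (hAsub : A ⊆ Icc (0 : ℝ) 1)
    (hAbd : (frontier A).Countable)
    (p : ℝ) (hp0 : 0 < p) (hp2 : p < 1 / 2)
    (p₁ : ℝ → ℝ)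
    (hp₁ : ∀ x, p₁ x = A.indicator (fun _ => p) x + Aᶜ.indicator (fun _ => 1 - p) x) :
    ∃ μ : Measure ℝ, IsProbabilityMeasure μ ∧ μ (Icc (0 : ℝ) 1) = 1 ∧
      ∀ B : Set ℝ, MeasurableSet B →
        μ B = ∫⁻ x,
          (ENNReal.ofReal (p₁ x) * B.indicator (fun _ => (1 : ℝ≥0∞)) (x / 3)
            + ENNReal.ofReal (1 - p₁ x) * B.indicator (fun _ => (1 : ℝ≥0∞)) ((x + 2) / 3)) ∂μ := by
  have hq0 : 0 ≤ 1 - p := by linarith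
  obtain ⟨μ, hμp, hμs, hμT⟩ := IFSaux.exists_inv (a := p.toNNReal) (b := (1 - p).toNNReal) hA hAbd
    (Real.toNNReal_le_toNNReal (by linarith))
    (by rw [← Real.toNNReal_add hp0.le hq0]; simp)
    (by rw [Real.coe_toNNReal _ hq0]; linarith)
    (by rw [← Real.toNNReal_one]; exact (Real.toNNReal_lt_toNNReal_iff one_pos).2 (by linarith))
  refine ⟨μ, hμp, (prob_compl_eq_zero_iff measurableSet_Icc).1 hμs, fun B hB => ?_⟩
  have h1 : Measurable (fun x : ℝ => x / 3) := by fun_prop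
  have h2 : Measurable (fun x : ℝ => (x + 2) / 3) := by fun_prop
  have key : ∀ (C : Set ℝ) (u v : ℝ≥0∞), MeasurableSet C →
      ∫⁻ x in C, (u * B.indicator (fun _ => (1 : ℝ≥0∞)) (x / 3)
        + v * B.indicator (fun _ => (1 : ℝ≥0∞)) ((x + 2) / 3)) ∂μ
      = u * μ ((fun x => x / 3) ⁻¹' B ∩ C) + v * μ ((fun x => (x + 2) / 3) ⁻¹' B ∩ C) := by
    intro C u v hC
    have hi : Measurable (B.indicator (fun _ => (1 : ℝ≥0∞))) := measurable_const.indicator hB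
    have hi1 : Measurable (fun x : ℝ => B.indicator (fun _ => (1 : ℝ≥0∞)) (x / 3)) := hi.comp h1
    have hi2 : Measurable (fun x : ℝ => B.indicator (fun _ => (1 : ℝ≥0∞)) ((x + 2) / 3)) :=
      hi.comp h2
    rw [lintegral_add_left (hi1.const_mul u), lintegral_const_mul _ hi1, lintegral_const_mul _ hi2]
    have e1 : ∫⁻ x in C, B.indicator (fun _ => (1 : ℝ≥0∞)) (x / 3) ∂μ
        = μ ((fun x => x / 3) ⁻¹' B ∩ C) := by
      rw [← Measure.restrict_apply (h1 hB), ← lintegral_indicator_one (h1 hB)]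
      rfl
    have e2 : ∫⁻ x in C, B.indicator (fun _ => (1 : ℝ≥0∞)) ((x + 2) / 3) ∂μ
        = μ ((fun x => (x + 2) / 3) ⁻¹' B ∩ C) := by
      rw [← Measure.restrict_apply (h2 hB), ← lintegral_indicator_one (h2 hB)]
      rfl
    rw [e1, e2]
  rw [← lintegral_add_compl _ hA]
  have i1 : ∫⁻ x in A, (ENNReal.ofReal (p₁ x) * B.indicator (fun _ => (1 : ℝ≥0∞)) (x / 3)
        + ENNReal.ofReal (1 - p₁ x) * B.indicator (fun _ => (1 : ℝ≥0∞)) ((x + 2) / 3)) ∂μ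
      = _ := (setLIntegral_congr_fun hA (fun x hx => by
        have : p₁ x = p := by rw [hp₁]; simp [hx]
        simp only [this])).trans (key A (ENNReal.ofReal p) (ENNReal.ofReal (1 - p)) hA)
  have i2 : ∫⁻ x in Aᶜ, (ENNReal.ofReal (p₁ x) * B.indicator (fun _ => (1 : ℝ≥0∞)) (x / 3)
        + ENNReal.ofReal (1 - p₁ x) * B.indicator (fun _ => (1 : ℝ≥0∞)) ((x + 2) / 3)) ∂μ
      = _ := (setLIntegral_congr_fun hA.compl (fun x hx => by
        have hx' : x ∉ A := hx
        have : p₁ x = 1 - p := by rw [hp₁]; simp [hx']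
        simp only [this, sub_sub_cancel])).trans
          (key Aᶜ (ENNReal.ofReal (1 - p)) (ENNReal.ofReal p) hA.compl)
  rw [i1, i2]
  conv_lhs => rw [← hμT]
  rw [IFSaux.T_apply _ _ _ hB]
  simp only [ENNReal.ofReal]
  ring
end

section
/- Let S₁(x) = x/3, S₂(x) = (x+2)/3 on X = [0,1], let A ⊆ [0,1] have at most countable boundary, p ∈ (0,1/2), p₁ = p on A and 1−p on Aᶜ, p₂ = 1−p₁. Then every ergodic invariant probability measure μ of this iterated function system satisfies dim_H(μ) ≤ −(p·log p + (1−p)·log(1−p)) / log 3. -/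
open MeasureTheory Set
open scoped ENNReal NNReal

namespace IFSDim
open Filter Topology

/-- the expanding map inverting both branches -/
noncomputable def T (x : ℝ) : ℝ := if x ≤ 1 / 2 then 3 * x else 3 * x - 2

/-- the first digit; `true` codes the branch `x / 3` -/
noncomputable def dig (x : ℝ) : Bool := if x ≤ 1 / 2 then true else false

/-- the branch maps -/
noncomputable def S (a : Bool) (y : ℝ) : ℝ := if a = true then y / 3 else (y + 2) / 3

/-- information cost of digit `a` at the point `y` for the transition function `q` -/
noncomputable def c (q : ℝ → ℝ) (a : Bool) (y : ℝ) : ℝ :=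
  -Real.log (if a = true then q y else 1 - q y)

/-- the information function -/
noncomputable def f (q : ℝ → ℝ) (x : ℝ) : ℝ := c q (dig x) (T x)

/-- base point of a cylinder -/
noncomputable def pt : List Bool → ℝ
  | [] => 0
  | a :: w => S a (pt w)

/-- total cost of a word -/
noncomputable def cost (q : ℝ → ℝ) : List Bool → ℝ
  | [] => 0
  | a :: w => c q a (pt w) + cost q w

/-- itinerary -/
noncomputable def itin : ℕ → ℝ → List Bool
  | 0, _ => []
  | n + 1, x => dig x :: itin n (T x)

/-- words of length `n` -/
def words : ℕ → Finset (List Bool)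
  | 0 => {[]}
  | n + 1 => (words n).image (fun w => true :: w) ∪ (words n).image (fun w => false :: w)

lemma itin_mem (n : ℕ) : ∀ x, itin n x ∈ words n := by
  induction n with
  | zero => intro x; simp [itin, words]
  | succ n ih =>
    intro x
    simp only [itin, words, Finset.mem_union, Finset.mem_image]
    cases dig x
    · right; exact ⟨_, ih (T x), rfl⟩
    · left; exact ⟨_, ih (T x), rfl⟩

lemma S_dig (x : ℝ) : S (dig x) (T x) = x := by
  unfold S dig T
  split_ifs <;> simp_all

lemma sum_words (q : ℝ → ℝ) (hq : ∀ y, 0 < q y ∧ q y < 1) (n : ℕ) :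
    ∑ w ∈ words n, Real.exp (-cost q w) = 1 := by
  induction n with
  | zero => simp [words, cost]
  | succ n ih =>
    rw [words, Finset.sum_union, Finset.sum_image, Finset.sum_image, ← Finset.sum_add_distrib, ← ih]
    · refine Finset.sum_congr rfl fun w _ => ?_
      have h := hq (pt w)
      simp only [cost, c, if_true, neg_add, neg_neg, Real.exp_add, reduceCtorEq, if_false]
      rw [Real.exp_log h.1, Real.exp_log (by linarith)]; ring
    · intro a _ b _ h; simpa using h
    · intro a _ b _ h; simpa using h
    · rw [Finset.disjoint_left]
      intro a ha hb
      simp only [Finset.mem_image] at ha hb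
      obtain ⟨_, _, rfl⟩ := ha
      obtain ⟨_, _, h⟩ := hb
      simp at h

lemma dist_pt (n : ℕ) : ∀ x, |x - pt (itin n x)| = |T^[n] x| / 3 ^ n := by
  induction n with
  | zero => intro x; simp [itin, pt]
  | succ n ih =>
    intro x
    have h1 : x - pt (itin (n+1) x) = (T x - pt (itin n (T x))) / 3 := by
      simp only [itin, pt]
      conv_lhs => rw [← S_dig x]
      have : dig (S (dig x) (T x)) = dig x := by rw [S_dig]
      have h2 : T (S (dig x) (T x)) = T x := by rw [S_dig]
      rw [this, h2]
      unfold S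
      split_ifs <;> ring
    rw [h1, abs_div, ih, Function.iterate_succ_apply, pow_succ, abs_of_pos (by norm_num : (0:ℝ) < 3)]
    field_simp

lemma cost_le (q : ℝ → ℝ) (M : ℝ) (hM : 0 ≤ M)
    (hq : ∀ a y y', |c q a y - c q a y'| ≤ M * |y - y'|) (n : ℕ) :
    ∀ x, T^[n] x ∈ Icc (0:ℝ) 1 →
      cost q (itin n x) ≤ birkhoffSum T (f q) n x + 3 * M * (1 - 1 / 3 ^ n) := by
  induction n with
  | zero => intro x _; simp [itin, cost]
  | succ n ih =>
    intro x hx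
    rw [Function.iterate_succ_apply] at hx
    have h1 := ih (T x) hx
    have h2 := hq (dig x) (pt (itin n (T x))) (T x)
    rw [abs_sub_comm (pt _), dist_pt] at h2
    have h3 : |T^[n] (T x)| ≤ 1 := abs_le.2 ⟨by linarith [hx.1], hx.2⟩
    have h4 : M * (|T^[n] (T x)| / 3 ^ n) ≤ M * (1 / 3 ^ n) := by gcongr
    have h5 := (abs_le.1 (h2.trans h4)).2
    rw [birkhoffSum_succ']
    simp only [itin, cost, f]
    have h6 : (1:ℝ) / 3 ^ n = 3 * (1 / 3 ^ (n+1)) := by rw [pow_succ]; field_simp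
    have : 0 ≤ M * (1 / 3 ^ (n+1)) := by positivity
    rw [h6] at h5 h1
    nlinarith

lemma card_le (q : ℝ → ℝ) (hq : ∀ y, 0 < q y ∧ q y < 1) (n : ℕ) (R : ℝ) :
    (((words n).filter (fun w => cost q w ≤ R)).card : ℝ) ≤ Real.exp R := by
  have h := sum_words q hq n
  have h1 : ∑ w ∈ (words n).filter (fun w => cost q w ≤ R), Real.exp (-R) ≤ 1 := by
    rw [← h]
    refine (Finset.sum_le_sum (g := fun w => Real.exp (-cost q w)) ?_).trans
      (Finset.sum_le_sum_of_subset_of_nonneg (Finset.filter_subset _ _) fun _ _ _ => (Real.exp_pos _).le)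
    intro w hw
    exact Real.exp_le_exp.2 (neg_le_neg (Finset.mem_filter.1 hw).2)
  rw [Finset.sum_const, nsmul_eq_mul, Real.exp_neg] at h1
  have := Real.exp_pos R
  field_simp at h1
  exact h1

/-- the Hausdorff dimension estimate from covers -/
lemma dimH_le_of_cover (E : ℕ → Set ℝ) (n : ℕ → ℕ) (hn : ∀ j, j ≤ n j) (W : ℕ → Finset (List Bool))
    (hE : ∀ j, ∀ x ∈ E j, ∃ w ∈ W j, |x - pt w| ≤ 1 / 3 ^ (n j)) (d : ℝ≥0)
    (hW : ∀ j, ((W j).card : ℝ) ≤ Real.exp (n j * (d * Real.log 3))) (J : ℕ) :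
    dimH (⋂ j ≥ J, E j) ≤ d := by
  apply dimH_le_of_hausdorffMeasure_ne_top
  have hr : Tendsto (fun j => ENNReal.ofReal (2 * (1 / 3) ^ (n j) : ℝ)) atTop (𝓝 0) := by
    have h1 : Tendsto n atTop atTop := tendsto_atTop_mono hn tendsto_id
    have h2 : Tendsto (fun j => (2 * (1 / 3) ^ (n j) : ℝ)) atTop (𝓝 (2 * 0)) :=
      ((tendsto_pow_atTop_nhds_zero_of_lt_one (by norm_num) (by norm_num)).comp h1).const_mul 2
    have := ENNReal.tendsto_ofReal h2
    simpa using this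
  have key := Measure.hausdorffMeasure_le_liminf_sum (ι := fun j => {w // w ∈ W j}) (d : ℝ)
    (⋂ j ≥ J, E j) _ hr (fun j w => Metric.closedBall (pt w) (1 / 3 ^ (n j))) ?_ ?_
  · refine ne_top_of_le_ne_top (b := ENNReal.ofReal (2 ^ (d:ℝ))) ENNReal.ofReal_ne_top (key.trans ?_)
    refine Filter.liminf_le_of_le (by isBoundedDefault) fun b hb => ?_
    obtain ⟨j, hj⟩ := hb.exists
    refine hj.trans ?_
    have : ∀ w : {w // w ∈ W j}, Metric.ediam (Metric.closedBall (pt w) (1 / 3 ^ (n j))) ^ (d:ℝ)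
        ≤ ENNReal.ofReal ((2 * (1 / 3) ^ (n j) : ℝ) ^ (d:ℝ)) := by
      intro w
      rw [← ENNReal.ofReal_rpow_of_nonneg (by positivity) (by positivity)]
      gcongr
      rw [Real.closedBall_eq_Icc, Real.ediam_Icc]
      apply ENNReal.ofReal_le_ofReal
      apply le_of_eq
      rw [div_pow, one_pow]; ring
    refine (Finset.sum_le_sum fun w _ => this w).trans ?_
    rw [Finset.sum_const, nsmul_eq_mul, ← ENNReal.ofReal_natCast, ← ENNReal.ofReal_mul (by positivity)]
    apply ENNReal.ofReal_le_ofReal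
    rw [Finset.card_univ, Fintype.card_coe, Real.mul_rpow (by norm_num) (by positivity)]
    have h3 : (((1:ℝ) / 3) ^ (n j)) ^ (d:ℝ) = Real.exp (-(n j * (d * Real.log 3))) := by
      rw [Real.rpow_def_of_pos (by positivity), Real.log_pow, one_div, Real.log_inv]
      congr 1; ring
    rw [h3, Real.exp_neg]
    have := hW j
    have h5 := Real.exp_pos (n j * (d * Real.log 3))
    calc ((W j).card : ℝ) * (2 ^ (d:ℝ) * (Real.exp (n j * (d * Real.log 3)))⁻¹)
        ≤ Real.exp (n j * (d * Real.log 3)) * (2 ^ (d:ℝ) * (Real.exp (n j * (d * Real.log 3)))⁻¹) := by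
          gcongr
      _ = _ := by field_simp
  · refine Eventually.of_forall fun j w => ?_
    rw [Real.closedBall_eq_Icc, Real.ediam_Icc]
    apply ENNReal.ofReal_le_ofReal
    apply le_of_eq
    rw [div_pow, one_pow]; ring
  · filter_upwards [eventually_ge_atTop J] with j hj x hx
    simp only [mem_iInter] at hx
    obtain ⟨w, hw, h⟩ := hE j x (hx j hj)
    refine mem_iUnion.2 ⟨⟨w, hw⟩, ?_⟩
    rw [Metric.mem_closedBall, Real.dist_eq]
    exact h

lemma log_lip {p u v : ℝ} (hp : 0 < p) (hu : p ≤ u) (hv : p ≤ v) :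
    |Real.log u - Real.log v| ≤ 1 / p * |u - v| := by
  have key : ∀ u v : ℝ, p ≤ u → p ≤ v → Real.log u - Real.log v ≤ 1 / p * |u - v| := by
    intro u v hu hv
    have hu0 : 0 < u := by linarith
    have hv0 : 0 < v := by linarith
    rw [← Real.log_div hu0.ne' hv0.ne']
    refine (Real.log_le_sub_one_of_pos (by positivity)).trans ?_
    have : u / v - 1 = 1 / v * (u - v) := by field_simp
    rw [this]
    have h1 : 1 / v ≤ 1 / p := one_div_le_one_div_of_le hp hv
    calc 1 / v * (u - v) ≤ 1 / v * |u - v| := by gcongr; exact le_abs_self _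
      _ ≤ _ := by gcongr
  rw [abs_le]
  constructor
  · have := key v u hv hu
    rw [abs_sub_comm] at this; linarith
  · exact key u v hu hv

/-- Lipschitz approximation of the transition function -/
lemma exists_q (A : Set ℝ) (hA : MeasurableSet A) (p : ℝ) (hp0 : 0 < p) (hp2 : p < 1 / 2)
    (p₁ : ℝ → ℝ) (h1 : ∀ x ∈ A, p₁ x = p) (h2 : ∀ x ∉ A, p₁ x = 1 - p)
    (μ : Measure ℝ) [IsProbabilityMeasure μ] (δ : ℝ) (hδ : 0 < δ) :
    ∃ q : ℝ → ℝ, Measurable q ∧ (∀ y, p ≤ q y ∧ q y ≤ 1 - p) ∧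
      (∃ M, 0 ≤ M ∧ ∀ a y y', |c q a y - c q a y'| ≤ M * |y - y'|) ∧
      ∃ B, MeasurableSet B ∧ μ.real B ≤ δ ∧ ∀ y ∉ B, q y = p₁ y := by
  have hδ' : ENNReal.ofReal (δ / 2) ≠ 0 := by simp [hδ]
  obtain ⟨K, hKA, hK, hμK⟩ := hA.exists_isCompact_sdiff_lt (measure_ne_top μ A) hδ'
  obtain ⟨K', hKA', hK', hμK'⟩ := hA.compl.exists_isCompact_sdiff_lt (measure_ne_top μ Aᶜ) hδ'
  have hd : Disjoint K K' := disjoint_of_subset hKA hKA' disjoint_compl_right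
  obtain ⟨r, hr, hrd⟩ := hd.exists_thickenings hK hK'.isClosed
  set g : ℝ → ℝ := fun x => (thickenedIndicator hr K x : ℝ) with hg
  have g0 : ∀ x, 0 ≤ g x := fun x => NNReal.coe_nonneg _
  have g1 : ∀ x, g x ≤ 1 := fun x => by exact_mod_cast thickenedIndicator_le_one hr K x
  obtain ⟨L, hL⟩ : ∃ L : ℝ≥0, LipschitzWith L (thickenedIndicator hr K) :=
    ⟨_, lipschitzWith_thickenedIndicator hr K⟩
  have gl : ∀ x y, |g x - g y| ≤ L * |x - y| := by
    intro x y
    have := hL.dist_le_mul x y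
    rwa [NNReal.dist_eq, Real.dist_eq] at this
  have gm : Measurable g := by
    have : Continuous g := NNReal.continuous_coe.comp (thickenedIndicator hr K).continuous
    exact this.measurable
  have hb : ∀ y, p ≤ (1 - p) - (1 - 2 * p) * g y ∧ (1 - p) - (1 - 2 * p) * g y ≤ 1 - p := by
    intro y
    have := g0 y
    have := g1 y
    constructor <;> nlinarith
  refine ⟨fun y => (1 - p) - (1 - 2 * p) * g y, by fun_prop, hb, ⟨1 / p * L, by positivity, ?_⟩,
    (A \ K) ∪ (Aᶜ \ K'), (hA.diff hK.measurableSet).union (hA.compl.diff hK'.measurableSet), ?_, ?_⟩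
  · intro a y y'
    have hs : |(1 - 2 * p) * (g y - g y')| ≤ L * |y - y'| := by
      rw [abs_mul, abs_of_pos (by linarith)]
      have := gl y y'
      have h3 := abs_nonneg (g y - g y')
      nlinarith
    have e : ∀ u v : ℝ, |-Real.log u - -Real.log v| = |Real.log u - Real.log v| := by
      intro u v; rw [← abs_neg]; congr 1; ring
    unfold c
    rw [e, mul_assoc]
    cases a
    · simp only [reduceCtorEq, if_false]
      refine (log_lip hp0 (by linarith [hb y]) (by linarith [hb y'])).trans ?_
      gcongr
      refine le_trans (le_of_eq ?_) hs
      congr 1; ring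
    · simp only [if_true]
      refine (log_lip hp0 (by linarith [hb y]) (by linarith [hb y'])).trans ?_
      gcongr
      refine le_trans (le_of_eq ?_) hs
      rw [← abs_neg]
      congr 1; ring
  · refine (measureReal_union_le _ _).trans ?_
    have e1 : μ.real (A \ K) ≤ δ / 2 := ENNReal.toReal_le_of_le_ofReal (by positivity) hμK.le
    have e2 : μ.real (Aᶜ \ K') ≤ δ / 2 := ENNReal.toReal_le_of_le_ofReal (by positivity) hμK'.le
    linarith
  · intro y hy
    simp only [mem_union, Set.mem_sdiff, mem_compl_iff, not_or, not_and, not_not] at hy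
    by_cases hyA : y ∈ A
    · have : g y = 1 := by
        simp only [hg]; rw [thickenedIndicator_one hr K (hy.1 hyA)]; rfl
      simp only [this]; rw [h1 y hyA]; ring
    · have : g y = 0 := by
        simp only [hg]; rw [thickenedIndicator_zero hr K]; rfl
        intro hyt
        exact (disjoint_left.1 hrd) hyt (Metric.self_subset_thickening hr _ (hy.2 hyA))
      simp only [this]; rw [h2 y hyA]; ring

lemma T_meas : Measurable T := by
  unfold T
  exact Measurable.ite measurableSet_Iic (by fun_prop) (by fun_prop)

lemma f_meas (q : ℝ → ℝ) (hq : Measurable q) : Measurable (f q) := by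
  have : f q = fun x => if x ≤ 1 / 2 then -Real.log (q (T x)) else -Real.log (1 - q (T x)) := by
    funext x
    unfold f c dig
    split_ifs <;> simp_all
  rw [this]
  have h := hq.comp T_meas
  exact Measurable.ite measurableSet_Iic (Real.measurable_log.comp h).neg
    (Real.measurable_log.comp (measurable_const.sub h)).neg

lemma c_bd {p : ℝ} (hp0 : 0 < p) {q : ℝ → ℝ} (hq : ∀ y, p ≤ q y ∧ q y ≤ 1 - p) (a : Bool) (y : ℝ) :
    0 ≤ c q a y ∧ c q a y ≤ -Real.log p := by
  have key : ∀ u, p ≤ u → u ≤ 1 - p → 0 ≤ -Real.log u ∧ -Real.log u ≤ -Real.log p := by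
    intro u h1 h2
    exact ⟨by linarith [Real.log_nonpos (by linarith : 0 ≤ u) (by linarith)],
      neg_le_neg (Real.log_le_log hp0 h1)⟩
  have := hq y
  unfold c
  split_ifs
  · exact key _ this.1 this.2
  · exact key _ (by linarith) (by linarith)

lemma bs_meas {g : ℝ → ℝ} (hg : Measurable g) (n : ℕ) : Measurable (birkhoffSum T g n) := by
  unfold birkhoffSum
  exact Finset.measurable_fun_sum _ fun k _ => hg.comp (T_meas.iterate k)

lemma bs_bd {g : ℝ → ℝ} {B : ℝ} (hg : ∀ x, |g x| ≤ B) (n : ℕ) (x : ℝ) :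
    |birkhoffSum T g n x| ≤ n * B := by
  unfold birkhoffSum
  refine (Finset.abs_sum_le_sum_abs _ _).trans ?_
  refine (Finset.sum_le_sum fun k _ => hg _).trans ?_
  simp

lemma int_bd (μ : Measure ℝ) [IsProbabilityMeasure μ] {g : ℝ → ℝ} (hm : Measurable g) {B : ℝ}
    (hg : ∀ x, |g x| ≤ B) : Integrable g μ :=
  Integrable.of_bound hm.aestronglyMeasurable B (Eventually.of_forall hg)

lemma T_S {x : ℝ} (hx : x ∈ Icc (0:ℝ) 1) : T (x / 3) = x ∧ T ((x + 2) / 3) = x := by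
  have := hx.1
  have := hx.2
  unfold T
  rw [if_pos (by linarith), if_neg (by linarith)]
  constructor <;> ring

lemma dig_S {x : ℝ} (hx : x ∈ Icc (0:ℝ) 1) : dig (x / 3) = true ∧ dig ((x + 2) / 3) = false := by
  have := hx.1
  have := hx.2
  unfold dig
  rw [if_pos (by linarith), if_neg (by linarith)]
  simp

section prob
variable {p : ℝ} (hp0 : 0 < p) (hp2 : p < 1 / 2) {p₁ : ℝ → ℝ} (hm : Measurable p₁)
    (hv : ∀ x, p₁ x = p ∨ p₁ x = 1 - p)
    (μ : Measure ℝ) [IsProbabilityMeasure μ] (hsupp : ∀ᵐ x ∂μ, x ∈ Icc (0 : ℝ) 1)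
    (hinv : ∀ B : Set ℝ, MeasurableSet B →
      μ B = ∫⁻ x,
        (ENNReal.ofReal (p₁ x) * B.indicator (fun _ => (1 : ℝ≥0∞)) (x / 3)
          + ENNReal.ofReal (1 - p₁ x) * B.indicator (fun _ => (1 : ℝ≥0∞)) ((x + 2) / 3)) ∂μ)

include hp0 hp2 hv in
lemma p1_bd (x : ℝ) : p ≤ p₁ x ∧ p₁ x ≤ 1 - p := by
  rcases hv x with h | h <;> rw [h] <;> constructor <;> linarith

include hm hinv in
lemma mu_eq : μ = (μ.withDensity (fun x => ENNReal.ofReal (p₁ x))).map (fun x => x / 3)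
    + (μ.withDensity (fun x => ENNReal.ofReal (1 - p₁ x))).map (fun x => (x + 2) / 3) := by
  ext B hB
  have m1 : Measurable (fun x : ℝ => x / 3) := by fun_prop
  have m2 : Measurable (fun x : ℝ => (x + 2) / 3) := by fun_prop
  have m3 : Measurable (fun x => ENNReal.ofReal (p₁ x)) := by fun_prop
  have m4 : Measurable (fun x => ENNReal.ofReal (1 - p₁ x)) := by fun_prop
  rw [Measure.add_apply, Measure.map_apply m1 hB, Measure.map_apply m2 hB,
    withDensity_apply _ (m1 hB), withDensity_apply _ (m2 hB), ← lintegral_indicator (m1 hB),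
    ← lintegral_indicator (m2 hB), ← lintegral_add_left (m3.indicator (m1 hB)), hinv B hB]
  congr 1
  funext x
  congr 1
  · by_cases h : x / 3 ∈ B <;> simp [indicator, h]
  · by_cases h : (x + 2) / 3 ∈ B <;> simp [indicator, h]

include hp0 hp2 hm hv hinv in
lemma int_eq (g : ℝ → ℝ) (hg : Measurable g) {B : ℝ} (hB : ∀ x, |g x| ≤ B) :
    ∫ x, g x ∂μ = ∫ x, (p₁ x * g (x / 3) + (1 - p₁ x) * g ((x + 2) / 3)) ∂μ := by
  have hb := p1_bd hp0 hp2 hv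
  have hgi : Integrable g μ := int_bd μ hg hB
  have m1 : Measurable (fun x : ℝ => x / 3) := by fun_prop
  have m2 : Measurable (fun x : ℝ => (x + 2) / 3) := by fun_prop
  have m3 : Measurable (fun x => ENNReal.ofReal (p₁ x)) := by fun_prop
  have m4 : Measurable (fun x => ENNReal.ofReal (1 - p₁ x)) := by fun_prop
  have he := mu_eq hm μ hinv
  have hgi2 := hgi
  rw [he] at hgi2
  have hi := integrable_add_measure.1 hgi2
  conv_lhs => rw [he]
  rw [integral_add_measure hi.1 hi.2, integral_map m1.aemeasurable hg.aestronglyMeasurable,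
    integral_map m2.aemeasurable hg.aestronglyMeasurable,
    integral_withDensity_eq_integral_toReal_smul m3 (by simp),
    integral_withDensity_eq_integral_toReal_smul m4 (by simp), ← integral_add]
  · congr 1
    funext x
    rw [ENNReal.toReal_ofReal (by linarith [hb x]), ENNReal.toReal_ofReal (by linarith [hb x])]
    simp
  · refine int_bd μ (B := 1 * B) (m3.ennreal_toReal.smul (hg.comp m1)) fun x => ?_
    rw [ENNReal.toReal_ofReal (by linarith [hb x]), smul_eq_mul, abs_mul]
    gcongr
    · rw [abs_le]; constructor <;> linarith [hb x]
    · exact hB _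
  · refine int_bd μ (B := 1 * B) (m4.ennreal_toReal.smul (hg.comp m2)) fun x => ?_
    rw [ENNReal.toReal_ofReal (by linarith [hb x]), smul_eq_mul, abs_mul]
    gcongr
    · rw [abs_le]; constructor <;> linarith [hb x]
    · exact hB _

include hp0 hp2 hv hsupp hinv in
lemma T_mp : MeasurePreserving T μ μ := by
  refine ⟨T_meas, ?_⟩
  have hb := p1_bd hp0 hp2 hv
  ext B hB
  rw [Measure.map_apply T_meas hB, hinv _ (T_meas hB), ← lintegral_indicator_one hB]
  apply lintegral_congr_ae
  filter_upwards [hsupp] with x hx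
  have h := T_S hx
  have e : ENNReal.ofReal (p₁ x) + ENNReal.ofReal (1 - p₁ x) = 1 := by
    rw [← ENNReal.ofReal_add (by linarith [hb x]) (by linarith [hb x])]; simp
  by_cases hxB : x ∈ B <;> simp [indicator, h.1, h.2, hxB, e]

include hp0 hp2 hm hv hsupp hinv in
lemma orth (ψ : ℝ → ℝ) (hψ : Measurable ψ) {B : ℝ} (hB : ∀ x, |ψ x| ≤ B) :
    ∫ x, (f p₁ x - -(p * Real.log p + (1 - p) * Real.log (1 - p))) * ψ (T x) ∂μ = 0 := by
  have hb := p1_bd hp0 hp2 hv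
  set h := -(p * Real.log p + (1 - p) * Real.log (1 - p)) with hh
  have hfb : ∀ x, |f p₁ x - h| ≤ -Real.log p + |h| := by
    intro x
    have := c_bd hp0 hb (dig x) (T x)
    refine (abs_sub _ _).trans ?_
    unfold f
    rw [abs_of_nonneg this.1]
    linarith
  rw [int_eq hp0 hp2 hm hv μ hinv (fun x => (f p₁ x - h) * ψ (T x))
    (((f_meas _ hm).sub_const _).mul (hψ.comp T_meas)) (B := (-Real.log p + |h|) * B)]
  · rw [integral_eq_zero_of_ae]
    filter_upwards [hsupp] with x hx
    obtain ⟨h1, h2⟩ := T_S hx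
    obtain ⟨h3, h4⟩ := dig_S hx
    simp only [f, h1, h2, h3, h4, c, if_true, reduceCtorEq, if_false, Pi.zero_apply]
    rcases hv x with e | e <;> rw [e, hh] <;> ring_nf
  · intro x
    rw [abs_mul]
    have := hfb x
    have h0 := abs_nonneg (f p₁ x - h)
    gcongr
    · linarith
    · exact hB _

include hp0 hp2 hm hv hsupp hinv in
lemma variance_le : ∃ D : ℝ, 0 ≤ D ∧ ∀ n : ℕ,
    ∫ x, (birkhoffSum T (fun x => f p₁ x - -(p * Real.log p + (1 - p) * Real.log (1 - p))) n x) ^ 2 ∂μ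
      ≤ n * D := by
  have hb := p1_bd hp0 hp2 hv
  have ho := fun ψ hψ B hB => orth hp0 hp2 hm hv μ hsupp hinv ψ hψ (B := B) hB
  have hmp := T_mp hp0 hp2 hv μ hsupp hinv
  set h := -(p * Real.log p + (1 - p) * Real.log (1 - p)) with hh
  set φ : ℝ → ℝ := fun x => f p₁ x - h with hφ
  have hφm : Measurable φ := (f_meas _ hm).sub_const _
  have hfb : ∀ x, |φ x| ≤ -Real.log p + |h| := by
    intro x
    have := c_bd hp0 hb (dig x) (T x)
    refine (abs_sub _ _).trans ?_
    unfold f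
    rw [abs_of_nonneg this.1]
    linarith
  set D := -Real.log p + |h|
  have hD : 0 ≤ D := (abs_nonneg _).trans (hfb 0)
  refine ⟨D ^ 2, by positivity, fun n => ?_⟩
  induction n with
  | zero => simp [birkhoffSum]
  | succ n ih =>
    have hsm := bs_meas hφm n
    have hsb := bs_bd hfb n
    have hnD : 0 ≤ n * D := by positivity
    have e : ∀ x, (birkhoffSum T φ (n+1) x) ^ 2 = φ x ^ 2
        + 2 * (φ x * birkhoffSum T φ n (T x)) + (birkhoffSum T φ n (T x)) ^ 2 := by
      intro x; rw [birkhoffSum_succ']; ring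
    have i1 : Integrable (fun x => φ x ^ 2) μ := int_bd μ (hφm.pow_const 2) (B := D ^ 2) fun x => by
      rw [abs_pow]; gcongr; exact hfb x
    have i2 : Integrable (fun x => 2 * (φ x * birkhoffSum T φ n (T x))) μ :=
      (int_bd μ (hφm.mul (hsm.comp T_meas)) (B := D * (n * D)) fun x => by
        simp only [Pi.mul_apply, Function.comp]
        rw [abs_mul]; gcongr
        · exact hfb x
        · exact hsb _).const_mul 2
    have i3 : Integrable (fun x => (birkhoffSum T φ n (T x)) ^ 2) μ :=
      int_bd μ ((hsm.comp T_meas).pow_const 2) (B := (n * D) ^ 2) fun x => by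
        rw [abs_pow]; gcongr; exact hsb _
    simp_rw [e]
    have i12 : Integrable (fun x => φ x ^ 2 + 2 * (φ x * birkhoffSum T φ n (T x))) μ := i1.add i2
    have ho' : ∫ x, φ x * birkhoffSum T φ n (T x) ∂μ = 0 := ho _ hsm _ hsb
    rw [integral_add i12 i3, integral_add i1 i2, integral_const_mul, ho']
    have e3 : ∫ x, (birkhoffSum T φ n (T x)) ^ 2 ∂μ = ∫ x, (birkhoffSum T φ n x) ^ 2 ∂μ := by
      have := integral_map (μ := μ) T_meas.aemeasurable
        (f := fun x => (birkhoffSum T φ n x) ^ 2) (hsm.pow_const 2).aestronglyMeasurable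
      rw [hmp.map_eq] at this
      exact this.symm
    have e1 : ∫ x, φ x ^ 2 ∂μ ≤ D ^ 2 := by
      have := integral_mono i1 (integrable_const (D ^ 2)) (fun x => by
        have := hfb x
        rw [← sq_abs]; gcongr)
      simpa using this
    rw [e3]
    push_cast
    linarith

include hp0 hp2 hm hv hsupp hinv in
lemma bad_le (ε : ℝ) (hε : 0 < ε) : ∃ D : ℝ, 0 ≤ D ∧
    ∀ (q : ℝ → ℝ) (δ : ℝ) (B : Set ℝ), Measurable q → (∀ y, p ≤ q y ∧ q y ≤ 1 - p) →
      MeasurableSet B → μ.real B ≤ δ → (∀ y ∉ B, q y = p₁ y) → ∀ n : ℕ, 0 < n →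
      μ.real {x | n * (-(p * Real.log p + (1 - p) * Real.log (1 - p)) + ε) < birkhoffSum T (f q) n x}
        ≤ D / n + D * δ := by
  have hb := p1_bd hp0 hp2 hv
  have hmp := T_mp hp0 hp2 hv μ hsupp hinv
  obtain ⟨D, hD, hvar⟩ := variance_le hp0 hp2 hm hv μ hsupp hinv
  set h := -(p * Real.log p + (1 - p) * Real.log (1 - p)) with hh
  set φ : ℝ → ℝ := fun x => f p₁ x - h with hφ
  have hφm : Measurable φ := (f_meas _ hm).sub_const _
  have hfb : ∀ x, |φ x| ≤ -Real.log p + |h| := by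
    intro x
    have := c_bd hp0 hb (dig x) (T x)
    refine (abs_sub _ _).trans ?_
    unfold f
    rw [abs_of_nonneg this.1]
    linarith
  set b := -Real.log p with hbdef
  have hb0 : 0 ≤ b := by have := c_bd hp0 hb true 0; linarith
  refine ⟨4 * D / ε ^ 2 + 2 * b / ε, by positivity, fun q δ B hqm hq hBm hBδ hBq n hn => ?_⟩
  have hδ : 0 ≤ δ := measureReal_nonneg.trans hBδ
  have hn' : (0:ℝ) < n := by exact_mod_cast hn
  set g : ℝ → ℝ := fun x => |f q x - f p₁ x| with hg
  have hgm : Measurable g := ((f_meas _ hqm).sub (f_meas _ hm)).abs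
  have hgb : ∀ x, g x ≤ b := by
    intro x
    have h1 := c_bd hp0 hb (dig x) (T x)
    have h2 := c_bd hp0 hq (dig x) (T x)
    simp only [hg, f]
    rw [abs_le]; constructor <;> linarith
  have hg0 : ∀ x, 0 ≤ g x := fun x => abs_nonneg _
  have hgb' : ∀ x, |g x| ≤ b := fun x => by rw [abs_of_nonneg (hg0 x)]; exact hgb x
  have hgint : ∫ x, g x ∂μ ≤ b * δ := by
    have h1 : ∀ x, g x ≤ (T ⁻¹' B).indicator (fun _ => b) x := by
      intro x
      by_cases hx : T x ∈ B
      · rw [indicator_of_mem (by exact hx)]; exact hgb x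
      · rw [indicator_of_notMem (by exact hx)]
        have : g x = 0 := by simp [hg, f, c, hBq _ hx]
        rw [this]
    have h2 := integral_mono (int_bd μ hgm hgb')
      ((integrable_const (μ := μ) b).indicator (T_meas hBm)) h1
    rw [integral_indicator_const _ (T_meas hBm)] at h2
    have h3 : μ.real (T ⁻¹' B) = μ.real B := hmp.measureReal_preimage hBm.nullMeasurableSet
    rw [h3, smul_eq_mul] at h2
    nlinarith
  have hgsum : ∀ n, ∫ x, birkhoffSum T g n x ∂μ = n * ∫ x, g x ∂μ := by
    intro n
    unfold birkhoffSum
    rw [integral_finsetSum]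
    · have : ∀ k, ∫ x, g (T^[k] x) ∂μ = ∫ x, g x ∂μ := by
        intro k
        have h1 := integral_map (μ := μ) (T_meas.iterate k).aemeasurable
          (f := g) hgm.aestronglyMeasurable
        rw [(hmp.iterate k).map_eq] at h1
        exact h1.symm
      simp [this]
    · intro k _
      exact int_bd μ (hgm.comp (T_meas.iterate k)) fun x => hgb' _
  have hsub : {x | n * (h + ε) < birkhoffSum T (f q) n x} ⊆
      {x | (n * (ε / 2)) ^ 2 ≤ (birkhoffSum T φ n x) ^ 2} ∪ {x | n * (ε / 2) ≤ birkhoffSum T g n x} := by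
    intro x hx
    by_contra hcon
    simp only [mem_union, Set.mem_ofPred_eq, not_or, not_le] at hcon hx
    have h1 := abs_lt_of_sq_lt_sq hcon.1 (by positivity)
    have h2 := (abs_lt.1 (by simpa using h1)).2
    have h3 : birkhoffSum T (f q) n x ≤ birkhoffSum T φ n x + n * h + birkhoffSum T g n x := by
      have e : (n:ℝ) * h = ∑ k ∈ Finset.range n, h := by simp
      rw [e]
      unfold birkhoffSum
      rw [← Finset.sum_add_distrib, ← Finset.sum_add_distrib]
      refine Finset.sum_le_sum fun k _ => ?_
      simp only [hφ, hg]
      linarith [le_abs_self (f q (T^[k] x) - f p₁ (T^[k] x))]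
    nlinarith [hcon.2]
  refine (measureReal_mono hsub).trans ((measureReal_union_le _ _).trans ?_)
  have k1 := mul_meas_ge_le_integral_of_nonneg (μ := μ)
    (f := fun x => (birkhoffSum T φ n x) ^ 2) (Eventually.of_forall fun x => sq_nonneg _)
    (int_bd μ ((bs_meas hφm n).pow_const 2) (B := (n * (b + |h|)) ^ 2) fun x => by
        rw [abs_pow]; gcongr; exact bs_bd hfb n x) ((n * (ε / 2)) ^ 2)
  have k2 := mul_meas_ge_le_integral_of_nonneg (μ := μ)
    (f := fun x => birkhoffSum T g n x)
    (Eventually.of_forall fun x => Finset.sum_nonneg fun k _ => hg0 _)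
    (int_bd μ (bs_meas hgm n) (bs_bd hgb' n)) (n * (ε / 2))
  have k1' := k1.trans (hvar n)
  rw [hgsum] at k2
  have k2' := k2.trans (mul_le_mul_of_nonneg_left hgint hn'.le)
  have j1 : μ.real {x | (n * (ε / 2)) ^ 2 ≤ (birkhoffSum T φ n x) ^ 2} ≤ 4 * D / ε ^ 2 / n := by
    rw [← le_div_iff₀' (by positivity)] at k1'
    refine k1'.trans (le_of_eq ?_)
    field_simp
    ring
  have j2 : μ.real {x | n * (ε / 2) ≤ birkhoffSum T g n x} ≤ 2 * b / ε * δ := by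
    rw [← le_div_iff₀' (by positivity)] at k2'
    refine k2'.trans (le_of_eq ?_)
    field_simp
  have j3 : 0 ≤ 4 * D / ε ^ 2 * δ := by positivity
  have j4 : 0 ≤ 2 * b / ε / n := by positivity
  rw [add_div, add_mul]
  linarith

end prob
end IFSDim

theorem stmt13 (A : Set ℝ) (hA : MeasurableSet A) (hAsub : A ⊆ Icc (0 : ℝ) 1)
    (hAbd : (frontier A).Countable)
    (p : ℝ) (hp0 : 0 < p) (hp2 : p < 1 / 2)
    (p₁ : ℝ → ℝ)
    (hp₁ : ∀ x, p₁ x = A.indicator (fun _ => p) x + Aᶜ.indicator (fun _ => 1 - p) x)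
    (μ : Measure ℝ) [IsProbabilityMeasure μ] (hsupp : μ (Icc (0 : ℝ) 1) = 1)
    (hinv : ∀ B : Set ℝ, MeasurableSet B →
      μ B = ∫⁻ x,
        (ENNReal.ofReal (p₁ x) * B.indicator (fun _ => (1 : ℝ≥0∞)) (x / 3)
          + ENNReal.ofReal (1 - p₁ x) * B.indicator (fun _ => (1 : ℝ≥0∞)) ((x + 2) / 3)) ∂μ)
    (herg : ∀ B : Set ℝ, MeasurableSet B →
      (∀ᵐ x ∂μ,
        ENNReal.ofReal (p₁ x) * B.indicator (fun _ => (1 : ℝ≥0∞)) (x / 3)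
          + ENNReal.ofReal (1 - p₁ x) * B.indicator (fun _ => (1 : ℝ≥0∞)) ((x + 2) / 3)
          = B.indicator (fun _ => (1 : ℝ≥0∞)) x) → μ B = 0 ∨ μ B = 1) :
    ⨅ (s : Set ℝ) (_ : MeasurableSet s) (_ : μ s = 1), dimH s
      ≤ ENNReal.ofReal (-(p * Real.log p + (1 - p) * Real.log (1 - p)) / Real.log 3) := by
  have h1 : ∀ x ∈ A, p₁ x = p := fun x hx => by rw [hp₁]; simp [hx]
  have h2 : ∀ x ∉ A, p₁ x = 1 - p := fun x hx => by rw [hp₁]; simp [hx]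
  have hv : ∀ x, p₁ x = p ∨ p₁ x = 1 - p := fun x => by
    by_cases hx : x ∈ A
    · exact Or.inl (h1 x hx)
    · exact Or.inr (h2 x hx)
  have hm : Measurable p₁ := by
    have : p₁ = fun x => A.indicator (fun _ => p) x + Aᶜ.indicator (fun _ => 1 - p) x := funext hp₁
    rw [this]
    exact (measurable_const.indicator hA).add (measurable_const.indicator hA.compl)
  have hs : ∀ᵐ x ∂μ, x ∈ Icc (0:ℝ) 1 := by
    rw [← mem_ae_iff_prob_eq_one measurableSet_Icc] at hsupp
    exact hsupp
  have hmp := IFSDim.T_mp hp0 hp2 hv μ hs hinv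
  refine le_of_forall_gt fun d' hd' => ?_
  obtain ⟨d, hd1, hd2⟩ := ENNReal.lt_iff_exists_nnreal_btwn.1 hd'
  refine lt_of_le_of_lt ?_ hd2
  have hl3 : 0 < Real.log 3 := Real.log_pos (by norm_num)
  set h := -(p * Real.log p + (1 - p) * Real.log (1 - p)) with hh
  have hd3 : h < d * Real.log 3 := by
    have : h / Real.log 3 < d := by
      by_contra hc
      push Not at hc
      have := ENNReal.ofReal_le_ofReal hc
      rw [ENNReal.ofReal_coe_nnreal] at this
      exact absurd hd1 (not_lt.2 this)
    rwa [div_lt_iff₀ hl3] at this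
  obtain ⟨ε, hε, hεd⟩ : ∃ ε : ℝ, 0 < ε ∧ h + 2 * ε = d * Real.log 3 :=
    ⟨(d * Real.log 3 - h) / 2, by linarith, by ring⟩
  obtain ⟨D, hD, hbad⟩ := IFSDim.bad_le hp0 hp2 hm hv μ hs hinv ε hε
  rw [← hh] at hbad
  have step : ∀ j : ℕ, ∃ (q : ℝ → ℝ) (n : ℕ) (M : ℝ), Measurable q ∧ (∀ y, p ≤ q y ∧ q y ≤ 1 - p) ∧
      0 ≤ M ∧ (∀ a y y', |IFSDim.c q a y - IFSDim.c q a y'| ≤ M * |y - y'|) ∧ j ≤ n ∧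
      3 * M ≤ n * ε ∧
      μ.real {x | n * (h + ε) < birkhoffSum IFSDim.T (IFSDim.f q) n x} ≤ (1 / 2) ^ j := by
    intro j
    obtain ⟨q, hqm, hq, ⟨M, hM, hqM⟩, B, hBm, hBδ, hBq⟩ :=
      IFSDim.exists_q A hA p hp0 hp2 p₁ h1 h2 μ ((1 / 2) ^ j / (2 * (D + 1))) (by positivity)
    obtain ⟨n, hn⟩ := exists_nat_ge (max (j + 1 : ℝ) (max (3 * M / ε) (D * (2 * 2 ^ j))))
    have n1 : (j + 1 : ℝ) ≤ n := (le_max_left _ _).trans hn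
    have n2 : 3 * M / ε ≤ n := ((le_max_left _ _).trans (le_max_right _ _)).trans hn
    have n3 : D * (2 * 2 ^ j) ≤ n := ((le_max_right _ _).trans (le_max_right _ _)).trans hn
    have n1' : j + 1 ≤ n := by exact_mod_cast n1
    have npos : (0:ℝ) < n := by have : 0 < n := by omega
                                exact_mod_cast this
    refine ⟨q, n, M, hqm, hq, hM, hqM, by omega, by rwa [div_le_iff₀ hε] at n2, ?_⟩
    refine (hbad q _ B hqm hq hBm hBδ hBq n (by omega)).trans ?_
    have e1 : D / n ≤ (1 / 2) ^ j / 2 := by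
      rw [div_le_iff₀ npos, div_pow, one_pow]
      have : (0:ℝ) < 2 ^ j := by positivity
      field_simp
      linarith
    have e2 : D * ((1 / 2) ^ j / (2 * (D + 1))) ≤ (1 / 2) ^ j / 2 := by
      have : D * ((1 / 2) ^ j / (2 * (D + 1))) = (D / (D + 1)) * ((1 / 2) ^ j / 2) := by
        field_simp
      rw [this]
      have h3 : D / (D + 1) ≤ 1 := by rw [div_le_one (by positivity)]; linarith
      exact mul_le_of_le_one_left (by positivity) h3
    linarith
  choose q n M hqm hq hM hqM hn hMn hμ using step
  set E : ℕ → Set ℝ := fun j => {x | IFSDim.T^[n j] x ∈ Icc (0:ℝ) 1} ∩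
    {x | birkhoffSum IFSDim.T (IFSDim.f (q j)) (n j) x ≤ n j * (h + ε)} with hE
  have hEm : ∀ j, MeasurableSet (E j) := fun j =>
    ((IFSDim.T_meas.iterate (n j)) measurableSet_Icc).inter
      (measurableSet_le (IFSDim.bs_meas (IFSDim.f_meas _ (hqm j)) _) measurable_const)
  have hEc : ∀ j, μ (E j)ᶜ ≤ ENNReal.ofReal ((1 / 2) ^ j) := by
    intro j
    have h0 : μ {x | IFSDim.T^[n j] x ∈ Icc (0:ℝ) 1}ᶜ = 0 :=
      (hmp.iterate (n j)).quasiMeasurePreserving.ae hs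
    have e : {x | birkhoffSum IFSDim.T (IFSDim.f (q j)) (n j) x ≤ n j * (h + ε)}ᶜ =
        {x | n j * (h + ε) < birkhoffSum IFSDim.T (IFSDim.f (q j)) (n j) x} := by
      ext x; simp
    rw [hE]
    simp only
    rw [compl_inter]
    refine (measure_union_le _ _).trans ?_
    rw [h0, zero_add, e]
    have := hμ j
    rw [← ENNReal.ofReal_toReal (measure_ne_top μ {x | n j * (h + ε) < birkhoffSum IFSDim.T (IFSDim.f (q j)) (n j) x})]
    exact ENNReal.ofReal_le_ofReal this
  have hsum : ∑' j, μ (E j)ᶜ ≠ ∞ := by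
    refine ne_top_of_le_ne_top ?_ (ENNReal.tsum_le_tsum hEc)
    exact (summable_geometric_of_lt_one (by norm_num) (by norm_num : (1/2:ℝ) < 1)).tsum_ofReal_ne_top
  have hae := ae_eventually_notMem hsum
  have hsm : MeasurableSet (⋃ J, ⋂ j ≥ J, E j) :=
    MeasurableSet.iUnion fun J => MeasurableSet.iInter fun j => MeasurableSet.iInter fun _ => hEm j
  have hs1 : μ (⋃ J, ⋂ j ≥ J, E j) = 1 := by
    rw [← mem_ae_iff_prob_eq_one hsm]
    filter_upwards [hae] with x hx
    obtain ⟨J, hJ⟩ := Filter.eventually_atTop.1 hx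
    refine mem_iUnion.2 ⟨J, ?_⟩
    simp only [mem_iInter]
    intro j hj
    have := hJ j hj
    simpa using this
  refine iInf_le_of_le (⋃ J, ⋂ j ≥ J, E j) (iInf_le_of_le hsm (iInf_le_of_le hs1 ?_))
  rw [dimH_iUnion]
  refine iSup_le fun J => ?_
  refine IFSDim.dimH_le_of_cover E n hn
    (fun j => (IFSDim.words (n j)).filter
      (fun w => IFSDim.cost (q j) w ≤ n j * (d * Real.log 3))) ?_ d ?_ J
  · intro j x hx
    refine ⟨IFSDim.itin (n j) x, Finset.mem_filter.2 ⟨IFSDim.itin_mem _ _, ?_⟩, ?_⟩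
    · have a1 := IFSDim.cost_le (q j) (M j) (hM j) (hqM j) (n j) x hx.1
      have a2 : birkhoffSum IFSDim.T (IFSDim.f (q j)) (n j) x ≤ n j * (h + ε) := hx.2
      have a3 := hMn j
      have a4 : 0 ≤ 3 * M j * (1 / 3 ^ (n j)) := by have := hM j; positivity
      rw [← hεd]
      nlinarith
    · rw [IFSDim.dist_pt]
      have a1 : IFSDim.T^[n j] x ∈ Icc (0:ℝ) 1 := hx.1
      gcongr
      rw [abs_le]; exact ⟨by linarith [a1.1], a1.2⟩
  · intro j
    exact IFSDim.card_le (q j) (fun y => ⟨by linarith [hq j y], by linarith [hq j y]⟩) _ _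
end
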